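/- For every integer n ≥ 2, the Baumslag–Solitar group BS(n,n) contains a subgroup of finite index isomorphic to ℤ × F_n, where F_n is the free group on n generators. More precisely, there is an injective group homomorphism φ : ℤ × F_n → BS(n,n), sending (1, ε) to a^n and (0, g_i) to a^i b a^{−i} for each generator g_i (i = 0, …, n−1) of F_n, whose image is a normal subgroup of BS(n,n) of index n, with quotient isomorphic to ℤ/nℤ. -/

import Mathlib

/-- The Baumslag–Solitar relation `b a^m b⁻¹ (a^n)⁻¹` in the free group on two generators. -/
def BSrel (m n : ℤ) : Set (FreeGroup (Fin 2)) :=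
  {FreeGroup.of 1 * FreeGroup.of 0 ^ m * (FreeGroup.of 1)⁻¹ * (FreeGroup.of 0 ^ n)⁻¹}

/-- The Baumslag–Solitar group `BS(m,n) = ⟨a, b ∣ b a^m b⁻¹ = a^n⟩`. -/
abbrev BS (m n : ℤ) : Type := PresentedGroup (BSrel m n)

/-- The generator `a` of `BS(m,n)`. -/
def BSa (m n : ℤ) : BS m n := PresentedGroup.of 0

/-- The generator `b` of `BS(m,n)`. -/
def BSb (m n : ℤ) : BS m n := PresentedGroup.of 1

theorem BSb_mul_BSa_zpow (n : ℤ) : BSb n n * BSa n n ^ n = BSa n n ^ n * BSb n n := by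
  have h : PresentedGroup.mk (BSrel n n) (FreeGroup.of 1 * FreeGroup.of 0 ^ n *
      (FreeGroup.of 1)⁻¹ * (FreeGroup.of 0 ^ n)⁻¹) = 1 :=
    PresentedGroup.one_of_mem rfl
  simp only [map_mul, map_inv, map_zpow] at h
  exact mul_inv_eq_iff_eq_mul.1 (mul_inv_eq_one.1 h)

namespace BS

/-- The conjugate `a^k b a^(-k)` in `BS(n,n)`. -/
def conjB (n k : ℤ) : BS n n := BSa n n ^ k * BSb n n * BSa n n ^ (-k)

theorem conjB_zero (n : ℤ) : conjB n 0 = BSb n n := by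
  simp [conjB]

theorem conj_conjB (n m k : ℤ) :
    BSa n n ^ m * conjB n k * (BSa n n ^ m)⁻¹ = conjB n (m + k) := by
  simp only [conjB]
  group

theorem commute_zpow_BSb (n q : ℤ) : Commute (BSa n n ^ (n * q)) (BSb n n) := by
  rw [zpow_mul]
  exact Commute.zpow_left (BSb_mul_BSa_zpow n).symm q

theorem conjB_add_mul (n k q : ℤ) : conjB n (k + n * q) = conjB n k := by
  have h : BSa n n ^ (n * q) * BSb n n * (BSa n n ^ (n * q))⁻¹ = BSb n n :=
    mul_inv_eq_iff_eq_mul.2 (commute_zpow_BSb n q)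
  calc conjB n (k + n * q)
      = BSa n n ^ k * (BSa n n ^ (n * q) * BSb n n * (BSa n n ^ (n * q))⁻¹) *
          BSa n n ^ (-k) := by simp only [conjB]; group
    _ = conjB n k := by rw [h, conjB]

theorem commute_zpow_conjB (n k : ℤ) : Commute (BSa n n ^ n) (conjB n k) := by
  have h := conj_conjB n n k
  rw [show n + k = k + n * 1 by ring, conjB_add_mul] at h
  exact mul_inv_eq_iff_eq_mul.1 h

/-- The homomorphism from the free group sending the `i`-th generator to `a^i b a^(-i)`. -/
def freeHom (n : ℕ) : FreeGroup (Fin n) →* BS (n : ℤ) (n : ℤ) :=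
  FreeGroup.lift fun i => conjB n (i : ℕ)

theorem freeHom_of (n : ℕ) (i : Fin n) : freeHom n (FreeGroup.of i) = conjB n (i : ℕ) := by
  simp [freeHom]

theorem commute_zpow_freeHom (n : ℕ) (w : FreeGroup (Fin n)) :
    Commute (BSa (n : ℤ) n ^ (n : ℤ)) (freeHom n w) := by
  induction w using FreeGroup.induction_on with
  | C1 => simp
  | of i => rw [freeHom_of]; exact commute_zpow_conjB _ _
  | inv_of i h => rw [map_inv]; exact h.inv_right
  | mul x y hx hy => rw [map_mul]; exact hx.mul_right hy

/-- The embedding `ℤ × F_n → BS(n,n)`. -/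
def prodHom (n : ℕ) : Multiplicative ℤ × FreeGroup (Fin n) →* BS (n : ℤ) (n : ℤ) :=
  (zpowersHom _ (BSa (n : ℤ) n ^ (n : ℤ))).noncommCoprod (freeHom n) fun k w => by
    rw [zpowersHom_apply]
    exact (commute_zpow_freeHom n w).zpow_left _

theorem prodHom_apply (n : ℕ) (x : Multiplicative ℤ × FreeGroup (Fin n)) :
    prodHom n x = BSa (n : ℤ) n ^ ((n : ℤ) * x.1.toAdd) * freeHom n x.2 := by
  rw [zpow_mul]
  rfl

/-- The homomorphism from `BS(n,n)` determined by the images `x` of `a` and `y` of `b`, where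
`x^n` commutes with `y`. -/
def lift {G : Type*} [Group G] (n : ℤ) (x y : G) (h : Commute (x ^ n) y) : BS n n →* G :=
  PresentedGroup.toGroup (f := ![x, y]) <| by
    rintro r rfl
    simp [← h.eq]

section lift

variable {G : Type*} [Group G] {n : ℤ} {x y : G} (h : Commute (x ^ n) y)

theorem lift_BSa : lift n x y h (BSa n n) = x := by
  simp [lift, BSa]

theorem lift_BSb : lift n x y h (BSb n n) = y := by
  simp [lift, BSb]

end lift

theorem hom_ext {G : Type*} [Group G] {m n : ℤ} {f g : BS m n →* G}
    (ha : f (BSa m n) = g (BSa m n)) (hb : f (BSb m n) = g (BSb m n)) : f = g :=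
  PresentedGroup.ext fun i => by
    fin_cases i
    exacts [ha, hb]

/-- The exponent sum of `a`. -/
def expA (n : ℤ) : BS n n →* Multiplicative ℤ :=
  lift n (Multiplicative.ofAdd 1) 1 (Commute.one_right _)

theorem expA_freeHom (n : ℕ) (w : FreeGroup (Fin n)) : expA n (freeHom n w) = 1 := by
  have : (expA n).comp (freeHom n) = 1 := by
    ext i
    simp [freeHom_of, conjB, expA, lift_BSa, lift_BSb]
  exact DFunLike.congr_fun this w

theorem expA_zpow (n k : ℤ) : expA n (BSa n n ^ k) = Multiplicative.ofAdd k := by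
  rw [map_zpow, expA, lift_BSa, ← ofAdd_zsmul]
  simp

/-- The action of `ℤ` on the free group by cyclic shifts of the generators. -/
def shift (n : ℕ) [NeZero n] : Multiplicative ℤ →* MulAut (FreeGroup (Fin n)) :=
  zpowersHom _ (FreeGroup.freeGroupCongr (Equiv.addRight (1 : Fin n)))

theorem shift_of (n : ℕ) [NeZero n] (k : ℕ) :
    shift n (Multiplicative.ofAdd (k : ℤ)) (FreeGroup.of 0) = FreeGroup.of (Fin.ofNat n k) := by
  simp only [shift, zpowersHom_apply, toAdd_ofAdd, zpow_natCast]
  induction k with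
  | zero => rfl
  | succ k ih =>
    rw [pow_succ', MulAut.mul_apply, ih, FreeGroup.freeGroupCongr_apply, FreeGroup.map.of]
    congr 1
    ext
    simp [Fin.val_add]

/-- The homomorphism from `BS(n,n)` to the semidirect product of `F_n` by the cyclic shift. -/
def toSemidirect (n : ℕ) [NeZero n] :
    BS (n : ℤ) (n : ℤ) →* FreeGroup (Fin n) ⋊[shift n] Multiplicative ℤ :=
  lift n (SemidirectProduct.inr (Multiplicative.ofAdd 1))
    (SemidirectProduct.inl (FreeGroup.of 0)) <| by
      rw [← map_zpow, ← ofAdd_zsmul, smul_eq_mul, mul_one]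
      refine mul_inv_eq_iff_eq_mul.1 ?_
      rw [← map_inv, ← SemidirectProduct.inl_aut, shift_of]
      simp

theorem toSemidirect_zpow (n : ℕ) [NeZero n] (k : ℤ) :
    toSemidirect n (BSa (n : ℤ) n ^ k) = SemidirectProduct.inr (Multiplicative.ofAdd k) := by
  rw [map_zpow, toSemidirect, lift_BSa, ← map_zpow, ← ofAdd_zsmul, smul_eq_mul, mul_one]

theorem toSemidirect_freeHom (n : ℕ) [NeZero n] (w : FreeGroup (Fin n)) :
    toSemidirect n (freeHom n w) = SemidirectProduct.inl w := by
  have : (toSemidirect n).comp (freeHom n) = SemidirectProduct.inl := by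
    refine FreeGroup.ext_hom _ _ fun i => ?_
    rw [MonoidHom.comp_apply, freeHom_of, conjB, zpow_neg, map_mul, map_mul, map_inv,
      toSemidirect_zpow, toSemidirect, lift_BSb, ← map_inv, ← SemidirectProduct.inl_aut, shift_of]
    simp
  exact DFunLike.congr_fun this w

theorem prodHom_injective (n : ℕ) [NeZero n] : Function.Injective (prodHom n) := by
  refine (injective_iff_map_eq_one _).2 fun ⟨k, w⟩ hx => ?_
  have h := congrArg (toSemidirect n) hx
  rw [prodHom_apply, map_mul, map_one, toSemidirect_zpow, toSemidirect_freeHom] at h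
  have hk : (n : ℤ) * k.toAdd = 0 := by
    have hr := congrArg (fun z => SemidirectProduct.rightHom z) h
    simp only [map_mul, SemidirectProduct.rightHom_inr, SemidirectProduct.rightHom_inl,
      mul_one, map_one] at hr
    exact ofAdd_eq_one.1 hr
  have hk : k = 1 := by
    simpa [NeZero.ne n] using hk
  subst hk
  have hw : w = 1 := by
    simpa using congrArg SemidirectProduct.left h
  rw [hw]
  rfl

theorem zpow_mem_range (n : ℕ) (q : ℤ) : BSa (n : ℤ) n ^ ((n : ℤ) * q) ∈ (prodHom n).range :=
  ⟨(Multiplicative.ofAdd q, 1), by simp [prodHom_apply]⟩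

theorem conjB_mem_range (n : ℕ) [NeZero n] (k : ℤ) : conjB n k ∈ (prodHom n).range := by
  have hn : (0 : ℤ) < n := by exact_mod_cast NeZero.pos n
  have h0 := Int.emod_nonneg k hn.ne'
  have h1 := Int.emod_lt_of_pos k hn
  refine ⟨(1, FreeGroup.of ⟨(k % n).toNat, by omega⟩), ?_⟩
  rw [prodHom_apply, freeHom_of]
  simp only [toAdd_one, mul_zero, zpow_zero, one_mul, Int.toNat_of_nonneg h0]
  rw [← conjB_add_mul n (k % n) (k / n), Int.emod_add_mul_ediv]

theorem conj_zpow_mem_range (n : ℕ) [NeZero n] (m : ℤ) {x : BS (n : ℤ) n}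
    (hx : x ∈ (prodHom n).range) :
    BSa (n : ℤ) n ^ m * x * (BSa (n : ℤ) n ^ m)⁻¹ ∈ (prodHom n).range := by
  obtain ⟨⟨k, w⟩, rfl⟩ := hx
  have hw : BSa (n : ℤ) n ^ m * freeHom n w * (BSa (n : ℤ) n ^ m)⁻¹ ∈ (prodHom n).range := by
    induction w using FreeGroup.induction_on with
    | C1 => simp
    | of i =>
      rw [freeHom_of, conj_conjB]
      exact conjB_mem_range n _
    | inv_of i h =>
      rw [map_inv, ← conj_inv]
      exact inv_mem h
    | mul x y hx hy =>
      rw [map_mul, ← conj_mul]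
      exact mul_mem hx hy
  rw [prodHom_apply, ← conj_mul, ← zpow_add, add_comm, zpow_add, mul_inv_cancel_right]
  exact mul_mem (zpow_mem_range n _) hw

theorem closure_BSa_BSb (m n : ℤ) : Subgroup.closure {BSa m n, BSb m n} = ⊤ := by
  rw [eq_top_iff, ← PresentedGroup.closure_range_of, Subgroup.closure_le]
  rintro _ ⟨i, rfl⟩
  apply Subgroup.subset_closure
  fin_cases i
  exacts [Or.inl rfl, Or.inr rfl]

theorem prodHom_range_normal (n : ℕ) [NeZero n] : (prodHom n).range.Normal := by
  rw [← Subgroup.normalizer_eq_top_iff, eq_top_iff, ← closure_BSa_BSb, Subgroup.closure_le]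
  rintro _ (rfl | rfl)
  · refine Subgroup.mem_normalizer_iff.2 fun x => ⟨fun hx => ?_, fun hx => ?_⟩
    · simpa using conj_zpow_mem_range n 1 hx
    · simpa [mul_assoc] using conj_zpow_mem_range n (-1) hx
  · exact Subgroup.le_normalizer (conjB_zero n ▸ conjB_mem_range n 0)

theorem mem_prodHom_range_iff (n : ℕ) [NeZero n] (x : BS (n : ℤ) n) :
    x ∈ (prodHom n).range ↔ (n : ℤ) ∣ (expA n x).toAdd := by
  constructor
  · rintro ⟨y, rfl⟩
    rw [prodHom_apply, map_mul, expA_freeHom, expA_zpow]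
    simp
  · rintro ⟨q, hq⟩
    have := prodHom_range_normal n
    have h : QuotientGroup.mk' (prodHom n).range =
        (zpowersHom _ (QuotientGroup.mk' (prodHom n).range (BSa (n : ℤ) n))).comp (expA n) := by
      apply hom_ext
      · simp [expA, lift_BSa]
      · have hb : BSb (n : ℤ) n ∈ (prodHom n).range := conjB_zero n ▸ conjB_mem_range n 0
        simpa [expA, lift_BSb] using hb
    rw [← QuotientGroup.eq_one_iff, ← QuotientGroup.mk'_apply, h, MonoidHom.comp_apply,
      zpowersHom_apply, hq, ← map_zpow, QuotientGroup.mk'_apply, QuotientGroup.eq_one_iff]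
    exact zpow_mem_range n q

/-- The homomorphism `BS(n,n) → ℤ/nℤ` sending `a` to `1` and `b` to `0`. -/
def toZMod (n : ℕ) : BS (n : ℤ) (n : ℤ) →* Multiplicative (ZMod n) :=
  (AddMonoidHom.toMultiplicative (Int.castAddHom (ZMod n))).comp (expA n)

theorem toZMod_surjective (n : ℕ) : Function.Surjective (toZMod n) := by
  intro z
  obtain ⟨k, hk⟩ := ZMod.intCast_surjective z.toAdd
  refine ⟨BSa (n : ℤ) n ^ k, ?_⟩
  rw [toZMod, MonoidHom.comp_apply, expA_zpow]
  exact congrArg Multiplicative.ofAdd hk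

theorem toZMod_ker (n : ℕ) [NeZero n] : (toZMod n).ker = (prodHom n).range := by
  ext x
  rw [mem_prodHom_range_iff, ← ZMod.intCast_zmod_eq_zero_iff_dvd]
  rfl

end BS

/-- For `n ≥ 2`, the group `BS(n,n)` contains `ℤ × F_n` as a normal subgroup of index `n`
with quotient `ℤ/nℤ`: there is an injective homomorphism `φ : ℤ × F_n → BS(n,n)` sending
`(1, ε)` to `a^n` and `(0, gᵢ)` to `aⁱ b a⁻ⁱ`, whose range is normal of index `n`, and a
surjective homomorphism `ψ : BS(n,n) → ℤ/nℤ` whose kernel is the range of `φ` (so the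
quotient `BS(n,n) / φ(ℤ × F_n)` is isomorphic to `ℤ/nℤ`). -/
theorem BSnn_contains_Z_times_Fn_finite_index (n : ℕ) (hn : 2 ≤ n) :
    ∃ (φ : Multiplicative ℤ × FreeGroup (Fin n) →* BS (n : ℤ) (n : ℤ))
      (ψ : BS (n : ℤ) (n : ℤ) →* Multiplicative (ZMod n)),
      Function.Injective φ ∧
      φ (Multiplicative.ofAdd 1, 1) = BSa (n : ℤ) (n : ℤ) ^ (n : ℤ) ∧
      (∀ i : Fin n,
        φ (1, FreeGroup.of i) =
          BSa (n : ℤ) (n : ℤ) ^ ((i : ℕ) : ℤ) * BSb (n : ℤ) (n : ℤ) *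
            BSa (n : ℤ) (n : ℤ) ^ (-((i : ℕ) : ℤ))) ∧
      φ.range.Normal ∧
      φ.range.index = n ∧
      Function.Surjective ψ ∧
      ψ.ker = φ.range := by
  have : NeZero n := ⟨by omega⟩
  refine ⟨BS.prodHom n, BS.toZMod n, BS.prodHom_injective n, ?_, fun i => ?_,
    BS.prodHom_range_normal n, ?_, BS.toZMod_surjective n, BS.toZMod_ker n⟩
  · simp [BS.prodHom_apply]
  · simp [BS.prodHom_apply, BS.freeHom_of, BS.conjB]
  · rw [← BS.toZMod_ker, Subgroup.index_ker,
      MonoidHom.range_eq_top.2 (BS.toZMod_surjective n), Subgroup.card_top]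
    exact Nat.card_zmod n
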